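/- If $w \in \widehat{A}_{q,2}$, i.e. $w = u (Mh_1)^{\alpha(1-q)} (Mh_2)^{(1-\alpha)(1-q)}$ for some $0 \le \alpha \le 1$, $u \in A_1$, and $h_1, h_2 \in L^1_{loc}$, then $w \in A_\infty$ and its factorization constant satisfies $[w]_{RH_\infty^1} \lesssim [u]_{A_1}$; in particular the factor $v = (Mh_1)^{\alpha(1-q)}(Mh_2)^{(1-\alpha)(1-q)}$ belongs to $RH_\infty$ with $[v]_{RH_\infty} \le C_{\alpha,q}$. -/

import Mathlib

open MeasureTheory ENNReal Set Filter

noncomputable section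

/-- The measure with density `w` with respect to the ambient volume. -/
def wMeasure {α : Type*} [MeasureSpace α] (w : α → ℝ) : Measure α :=
  (volume : Measure α).withDensity fun x => ENNReal.ofReal (w x)

/-- The weak Lorentz `L^{q,∞}(μ)` quasi-norm. -/
def wLorentz {α E : Type*} [MeasurableSpace α] [Norm E] (q : ℝ) (μ : Measure α)
    (g : α → E) : ℝ≥0∞ :=
  ⨆ (t : ℝ) (_ : 0 < t), ENNReal.ofReal t * μ {x | t < ‖g x‖} ^ (1 / q)

/-- The weak Lorentz `L^{q,∞}(μ)` quasi-norm, for `ℝ≥0∞`-valued functions. -/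
def wLorentzE {α : Type*} [MeasurableSpace α] (q : ℝ) (μ : Measure α)
    (g : α → ℝ≥0∞) : ℝ≥0∞ :=
  ⨆ (t : ℝ) (_ : 0 < t), ENNReal.ofReal t * μ {x | ENNReal.ofReal t < g x} ^ (1 / q)

/-- The Lorentz `L^{p,r}(μ)` quasi-norm (computed via the distribution function). -/
def lorentz {α E : Type*} [MeasurableSpace α] [Norm E] (p r : ℝ) (μ : Measure α)
    (g : α → E) : ℝ≥0∞ :=
  (∫⁻ t in Set.Ioi (0 : ℝ), ENNReal.ofReal (t ^ (r - 1)) * μ {x | t < ‖g x‖} ^ (r / p)) ^ (1 / r)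

/-- A weight: a locally integrable, a.e. positive function. -/
def IsWeight {α : Type*} [MeasureSpace α] [TopologicalSpace α] (w : α → ℝ) : Prop :=
  LocallyIntegrable w volume ∧ ∀ᵐ x : α ∂volume, 0 < w x

abbrev Rn (n : ℕ) : Type := Fin n → ℝ

/-- The axis-parallel closed cube with center `c` and half side-length `r`. -/
def cube {n : ℕ} (c : Rn n) (r : ℝ) : Set (Rn n) := {x | ∀ i, |x i - c i| ≤ r}

/-- The Hardy–Littlewood maximal operator over cubes. -/
def maxOp {n : ℕ} (f : Rn n → ℝ) (x : Rn n) : ℝ≥0∞ :=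
  ⨆ (c : Rn n) (r : ℝ) (_ : 0 < r) (_ : x ∈ cube c r),
    (∫⁻ y in cube c r, ENNReal.ofReal |f y|) / volume (cube c r)

/-- The `A₁` constant: the least `C` with `Mu ≤ C u` a.e. -/
def A1Const {n : ℕ} (u : Rn n → ℝ) : ℝ≥0∞ :=
  sInf {C : ℝ≥0∞ | ∀ᵐ x : Rn n ∂volume, maxOp u x ≤ C * ENNReal.ofReal (u x)}

def MemA1 {n : ℕ} (u : Rn n → ℝ) : Prop := IsWeight u ∧ A1Const u < ⊤

/-- The `RH∞` constant `sup_Q (ess sup_Q v) |Q| / v(Q)`. -/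
def RHinfConst {n : ℕ} (v : Rn n → ℝ) : ℝ≥0∞ :=
  ⨆ (c : Rn n) (r : ℝ) (_ : 0 < r),
    essSup (fun x => ENNReal.ofReal (v x)) (volume.restrict (cube c r)) * volume (cube c r)
      / wMeasure v (cube c r)

/-- The Fujii–Wilson `A∞` constant. -/
def FWConst {n : ℕ} (w : Rn n → ℝ) : ℝ≥0∞ :=
  ⨆ (c : Rn n) (r : ℝ) (_ : 0 < r),
    (∫⁻ x in cube c r, maxOp ((cube c r).indicator w) x) / wMeasure w (cube c r)

/-- The Muckenhoupt `A_q` constant, `q > 1`. -/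
def AqConst {n : ℕ} (q : ℝ) (w : Rn n → ℝ) : ℝ≥0∞ :=
  ⨆ (c : Rn n) (r : ℝ) (_ : 0 < r),
    (wMeasure w (cube c r) / volume (cube c r)) *
      ((∫⁻ x in cube c r, ENNReal.ofReal (w x ^ (1 - q / (q - 1)))) / volume (cube c r)) ^ (q - 1)

/-- Membership in `A∞ = ⋃_{q>1} A_q`. -/
def MemAinf {n : ℕ} (w : Rn n → ℝ) : Prop := ∃ q : ℝ, 1 < q ∧ AqConst q w < ⊤

/-- The restricted `A_q^𝓡` constant. -/
def AqRConst {n : ℕ} (q : ℝ) (w : Rn n → ℝ) : ℝ≥0∞ :=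
  ⨆ (c : Rn n) (r : ℝ) (_ : 0 < r) (E : Set (Rn n)) (_ : MeasurableSet E)
    (_ : E ⊆ cube c r) (_ : 0 < volume E),
    volume E / volume (cube c r) * (wMeasure w (cube c r) / wMeasure w E) ^ (1 / q)

/-- The constant `[w]_{RH∞¹} = inf {[u]_{A₁}[v]_{RH∞} : w = uv}`. -/
def RH1Const {n : ℕ} (w : Rn n → ℝ) : ℝ≥0∞ :=
  sInf {C : ℝ≥0∞ | ∃ u v : Rn n → ℝ, (∀ x, w x = u x * v x) ∧ MemA1 u ∧ IsWeight v ∧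
    RHinfConst v < ⊤ ∧ C = A1Const u * RHinfConst v}

/-- `S f = (M(|Tf|^{1/2}))²`. -/
def Sop {n : ℕ} (T : (Rn n → ℝ) → Rn n → ℝ) (f : Rn n → ℝ) (x : Rn n) : ℝ≥0∞ :=
  maxOp (fun y => |T f y| ^ ((2 : ℝ)⁻¹)) x ^ (2 : ℝ)

/-- Condition (C): for some `p₀` and increasing `φ`,
`∫ (Sf)^{p₀} w ≤ φ([w]_{A∞}) ∫ (Mf)^{p₀} w` for all `w ∈ A∞`. -/
def ConditionC {n : ℕ} (T : (Rn n → ℝ) → Rn n → ℝ) : Prop :=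
  ∃ p0 : ℝ, 0 < p0 ∧ ∃ φ : ℝ≥0∞ → ℝ≥0∞, Monotone φ ∧
    ∀ w : Rn n → ℝ, IsWeight w → MemAinf w → ∀ f : Rn n → ℝ, Measurable f →
      (∫⁻ x, Sop T f x ^ p0 * ENNReal.ofReal (w x)) < ⊤ →
      (∫⁻ x, Sop T f x ^ p0 * ENNReal.ofReal (w x)) ≤
        φ (FWConst w) * ∫⁻ x, maxOp f x ^ p0 * ENNReal.ofReal (w x)


theorem cube_eq_closedBall {n : ℕ} (c : Rn n) {r : ℝ} (hr : 0 ≤ r) :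
    cube c r = Metric.closedBall c r := by
  ext x
  simp [cube, dist_pi_le_iff hr, Real.dist_eq]

theorem measurableSet_cube {n : ℕ} (c : Rn n) {r : ℝ} (hr : 0 ≤ r) :
    MeasurableSet (cube c r) := by
  rw [cube_eq_closedBall c hr]
  exact Metric.isClosed_closedBall.measurableSet

theorem volume_cube {n : ℕ} (c : Rn n) {r : ℝ} (hr : 0 ≤ r) :
    volume (cube c r) = ENNReal.ofReal ((2 * r) ^ n) := by
  rw [cube_eq_closedBall c hr, Real.volume_pi_closedBall c hr, Fintype.card_fin]

theorem volume_cube_ne_zero {n : ℕ} (c : Rn n) {r : ℝ} (hr : 0 < r) :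
    volume (cube c r) ≠ 0 := by
  rw [volume_cube c hr.le]
  exact (ENNReal.ofReal_pos.2 (by positivity)).ne'

theorem volume_cube_ne_top {n : ℕ} (c : Rn n) {r : ℝ} (hr : 0 ≤ r) :
    volume (cube c r) ≠ ⊤ := by
  rw [volume_cube c hr]
  exact ENNReal.ofReal_ne_top

theorem volume_cube_mul {n : ℕ} (c c' : Rn n) (k : ℕ) {r : ℝ} (hr : 0 ≤ r) :
    volume (cube c (k * r)) = k ^ n * volume (cube c' r) := by
  rw [volume_cube c (by positivity), volume_cube c' hr,
    show (2 * (k * r)) ^ n = (k : ℝ) ^ n * (2 * r) ^ n by ring,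
    ENNReal.ofReal_mul (by positivity), ENNReal.ofReal_pow (by positivity), ENNReal.ofReal_natCast]

theorem setLIntegral_cube_div_le_maxOp {n : ℕ} (f : Rn n → ℝ) (c x : Rn n) {r : ℝ} (hr : 0 < r)
    (hx : x ∈ cube c r) :
    (∫⁻ y in cube c r, ENNReal.ofReal |f y|) / volume (cube c r) ≤ maxOp f x :=
  le_iSup₂_of_le c r (le_iSup₂_of_le hr hx le_rfl)

theorem lt_maxOp_iff {n : ℕ} {f : Rn n → ℝ} {x : Rn n} {t : ℝ≥0∞} :
    t < maxOp f x ↔ ∃ (c : Rn n) (r : ℝ), 0 < r ∧ x ∈ cube c r ∧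
      t < (∫⁻ y in cube c r, ENNReal.ofReal |f y|) / volume (cube c r) := by
  simp only [maxOp, lt_iSup_iff, exists_prop]

theorem lowerSemicontinuous_maxOp {n : ℕ} (f : Rn n → ℝ) : LowerSemicontinuous (maxOp f) := by
  intro x t ht
  obtain ⟨c, r, hr, hx, hlt⟩ := lt_maxOp_iff.1 ht
  set I := ∫⁻ y in cube c r, ENNReal.ofReal |f y|
  have hvol : Tendsto (fun s : ℝ => ENNReal.ofReal ((2 * s) ^ n)) (nhds r)
      (nhds (volume (cube c r))) := by
    rw [volume_cube c hr.le]
    exact (ENNReal.continuous_ofReal.comp (by fun_prop)).tendsto r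
  have hdiv : Tendsto (fun s : ℝ => I / ENNReal.ofReal ((2 * s) ^ n)) (nhds r)
      (nhds (I / volume (cube c r))) :=
    ENNReal.Tendsto.const_div hvol (Or.inl (volume_cube_ne_top c hr.le))
  obtain ⟨s, hs, hrs⟩ := (((hdiv.mono_left nhdsWithin_le_nhds).eventually_const_lt hlt).and
    (self_mem_nhdsWithin (s := Ioi r))).exists
  have hrs' : r < s := hrs
  rw [← volume_cube c (hr.trans hrs').le] at hs
  rw [cube_eq_closedBall c hr.le] at hx
  have hmem : Metric.ball c s ∈ nhds x :=
    Metric.isOpen_ball.mem_nhds (lt_of_le_of_lt hx hrs')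
  filter_upwards [hmem] with y hy
  have hy' : y ∈ cube c s := by
    rw [cube_eq_closedBall c (hr.trans hrs').le]
    exact Metric.ball_subset_closedBall hy
  refine hs.trans_le (le_trans ?_ (setLIntegral_cube_div_le_maxOp f c y (hr.trans hrs') hy'))
  gcongr
  exact lintegral_mono_set fun z hz i => (hz i).trans hrs'.le

theorem measurable_maxOp {n : ℕ} (f : Rn n → ℝ) : Measurable (maxOp f) :=
  (lowerSemicontinuous_maxOp f).measurable

/-- The infimum of the maximal function over a cube. -/
def infMaxOp {n : ℕ} (f : Rn n → ℝ) (c : Rn n) (r : ℝ) : ℝ≥0∞ := ⨅ y ∈ cube c r, maxOp f y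

theorem setLIntegral_cube_le_infMaxOp {n : ℕ} (f : Rn n → ℝ) {c c' : Rn n} {r r' : ℝ}
    (hr' : 0 < r') (h : cube c r ⊆ cube c' r') :
    (∫⁻ y in cube c' r', ENNReal.ofReal |f y|) ≤ infMaxOp f c r * volume (cube c' r') := by
  refine (ENNReal.div_le_iff (volume_cube_ne_zero c' hr') (volume_cube_ne_top c' hr'.le)).1 ?_
  exact le_iInf₂ fun y hy => setLIntegral_cube_div_le_maxOp f c' y hr' (h hy)

/-- A local weak type bound for the maximal function, normalised by its infimum on the cube. -/
theorem volume_maxOp_gt_mul_le {n : ℕ} (f : Rn n → ℝ) (c : Rn n) {R : ℝ} (hR : 0 < R)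
    (hm0 : infMaxOp f c R ≠ 0) (hmt : infMaxOp f c R ≠ ⊤) (l : ℝ≥0∞) :
    volume {x ∈ cube c R | l * infMaxOp f c R < maxOp f x} * l ≤ 15 ^ n * volume (cube c R) := by
  set m := infMaxOp f c R with hm
  set S := {x ∈ cube c R | l * m < maxOp f x}
  rcases eq_or_ne l ⊤ with rfl | hlt
  · have : S = ∅ := by
      ext x; simp [S, ENNReal.top_mul hm0]
    simp [this]
  rcases le_or_gt l (3 ^ n) with hl | hl
  · calc volume S * l ≤ volume (cube c R) * 3 ^ n := by
          gcongr
          exact fun x hx => hx.1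
      _ ≤ volume (cube c R) * 15 ^ n := by
          gcongr; norm_num
      _ = _ := mul_comm _ _
  have hl0 : l ≠ 0 := (lt_of_le_of_lt (zero_le) hl).ne'
  have hex : ∀ x ∈ S, ∃ (d : Rn n) (r : ℝ), 0 < r ∧ x ∈ cube d r ∧
      l * m < (∫⁻ y in cube d r, ENNReal.ofReal |f y|) / volume (cube d r) :=
    fun x hx => lt_maxOp_iff.1 hx.2
  choose! d r hr hxd hlt' using hex
  have hrR : ∀ x ∈ S, r x ≤ R := by
    intro x hx
    by_contra! hcon
    have hsub : cube c R ⊆ cube (d x) ((3 : ℕ) * r x) := by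
      intro y hy i
      have h1 := abs_le.1 (hy i)
      have h2 := abs_le.1 (hx.1 i)
      have h3 := abs_le.1 (hxd x hx i)
      push_cast
      rw [abs_le]
      constructor <;> linarith
    have h3r : 0 < ((3 : ℕ) : ℝ) * r x := by have := hr x hx; positivity
    have h1 := setLIntegral_cube_le_infMaxOp f h3r hsub
    have h2 : l * m * volume (cube (d x) (r x)) < ∫⁻ y in cube (d x) (r x), ENNReal.ofReal |f y| :=
      (ENNReal.lt_div_iff_mul_lt (Or.inl (volume_cube_ne_zero _ (hr x hx)))
        (Or.inl (volume_cube_ne_top _ (hr x hx).le))).1 (hlt' x hx)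
    rw [volume_cube_mul (d x) (d x) 3 (hr x hx).le] at h1
    have h4 : (∫⁻ y in cube (d x) (r x), ENNReal.ofReal |f y|) ≤
        ∫⁻ y in cube (d x) ((3 : ℕ) * r x), ENNReal.ofReal |f y| :=
      lintegral_mono_set fun z hz i => (hz i).trans (by have := hr x hx; push_cast; linarith)
    have h5 := (h2.trans_le (h4.trans h1))
    rw [← hm, mul_comm l m, mul_assoc, Nat.cast_ofNat] at h5
    refine absurd h5 (not_lt.2 ?_)
    gcongr
  obtain ⟨u, huS, hdisj, hcov⟩ := Vitali.exists_disjoint_subfamily_covering_enlargement_closedBall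
    S d r R hrR 5 (by norm_num)
  have hdisj' : u.PairwiseDisjoint fun a => cube (d a) (r a) := by
    intro a ha b hb hab
    simp only [Function.onFun]
    rw [cube_eq_closedBall _ (hr a (huS ha)).le, cube_eq_closedBall _ (hr b (huS hb)).le]
    exact hdisj ha hb hab
  have hcount : u.Countable := by
    refine hdisj.countable_of_nonempty_interior fun a ha => ?_
    exact (Metric.nonempty_ball.2 (hr a (huS ha))).mono Metric.ball_subset_interior_closedBall
  have hSsub : S ⊆ ⋃ a ∈ u, cube (d a) ((5 : ℕ) * r a) := by
    intro x hx
    obtain ⟨b, hb, hsub⟩ := hcov x hx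
    have hb0 := hr b (huS hb)
    refine mem_iUnion₂.2 ⟨b, hb, ?_⟩
    rw [cube_eq_closedBall _ (by positivity)]
    refine hsub ?_
    rw [← cube_eq_closedBall _ (hr x hx).le]
    exact hxd x hx
  have hbig : ∀ a ∈ u, cube (d a) (r a) ⊆ cube c ((3 : ℕ) * R) := by
    intro a ha y hy i
    have h1 := abs_le.1 (hy i)
    have h2 := abs_le.1 ((huS ha).1 i)
    have h3 := abs_le.1 (hxd a (huS ha) i)
    have h4 := hrR a (huS ha)
    push_cast
    rw [abs_le]
    constructor <;> linarith
  have h3R : 0 < ((3 : ℕ) : ℝ) * R := by positivity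
  have hmain : volume S * l * m ≤ 15 ^ n * volume (cube c R) * m := by
    calc volume S * l * m
        ≤ (∑' a : u, volume (cube (d a) ((5 : ℕ) * r a))) * l * m := by
          gcongr
          exact (measure_mono hSsub).trans (measure_biUnion_le _ hcount _)
      _ = 5 ^ n * ∑' a : u, (l * m * volume (cube (d a) (r a))) := by
          rw [ENNReal.tsum_mul_left]
          have : ∀ a : u, volume (cube (d a) ((5 : ℕ) * r a)) =
              5 ^ n * volume (cube (d a) (r a)) := fun a => by
            rw [volume_cube_mul (d a) (d a) 5 (hr a (huS a.2)).le, Nat.cast_ofNat]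
          simp_rw [this, ENNReal.tsum_mul_left]
          ring
      _ ≤ 5 ^ n * ∑' a : u, ∫⁻ y in cube (d a) (r a), ENNReal.ofReal |f y| := by
          gcongr with a
          exact ((ENNReal.lt_div_iff_mul_lt
            (Or.inl (volume_cube_ne_zero _ (hr a (huS a.2))))
            (Or.inl (volume_cube_ne_top _ (hr a (huS a.2)).le))).1 (hlt' a (huS a.2))).le
      _ = 5 ^ n * ∫⁻ y in ⋃ a ∈ u, cube (d a) (r a), ENNReal.ofReal |f y| := by
          rw [lintegral_biUnion hcount
            (fun a ha => measurableSet_cube _ (hr a (huS ha)).le) hdisj']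
      _ ≤ 5 ^ n * ∫⁻ y in cube c ((3 : ℕ) * R), ENNReal.ofReal |f y| := by
          gcongr
          exact iUnion₂_subset hbig
      _ ≤ 5 ^ n * (m * volume (cube c ((3 : ℕ) * R))) := by
          gcongr
          refine setLIntegral_cube_le_infMaxOp f h3R fun y hy i => (hy i).trans ?_
          push_cast; linarith
      _ = 15 ^ n * volume (cube c R) * m := by
          rw [volume_cube_mul c c 3 hR.le, Nat.cast_ofNat,
            show (15 : ℝ≥0∞) = 5 * 3 by norm_num, mul_pow]
          ring
  exact (ENNReal.mul_le_mul_iff_left hm0 hmt).1 hmain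

theorem infMaxOp_ne_top {n : ℕ} {f : Rn n → ℝ} (hf : ∀ᵐ x : Rn n ∂volume, maxOp f x < ⊤)
    (c : Rn n) {r : ℝ} (hr : 0 < r) : infMaxOp f c r ≠ ⊤ := by
  intro htop
  refine volume_cube_ne_zero c hr (measure_mono_null (fun x hx => ?_) hf)
  have : infMaxOp f c r ≤ maxOp f x := iInf₂_le x hx
  simpa [htop] using this

theorem infMaxOp_ne_zero {n : ℕ} {f : Rn n → ℝ} (hf : ∀ᵐ x : Rn n ∂volume, 0 < maxOp f x)
    (c : Rn n) {r : ℝ} (hr : 0 < r) : infMaxOp f c r ≠ 0 := by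
  obtain ⟨x, hx⟩ := hf.exists
  obtain ⟨d, s, hs, -, hlt⟩ := lt_maxOp_iff.1 hx
  have hlt' : 0 < ∫⁻ y in cube d s, ENNReal.ofReal |f y| := by
    by_contra! h
    simp [nonpos_iff_eq_zero.1 h] at hlt
  intro h0
  have ht : 0 < dist c d + r + s := by positivity
  have h1 : cube c r ⊆ cube d (dist c d + r + s) := by
    rw [cube_eq_closedBall _ hr.le, cube_eq_closedBall _ ht.le]
    exact Metric.closedBall_subset_closedBall' (by linarith)
  have h2 := setLIntegral_cube_le_infMaxOp f ht h1
  rw [h0, zero_mul] at h2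
  refine absurd (hlt'.trans_le ((lintegral_mono_set fun y hy i => (hy i).trans ?_).trans h2))
    (lt_irrefl _)
  linarith [dist_nonneg (x := c) (y := d)]

/-- A Kolmogorov-type bound: the square root of the maximal function has average over a cube
comparable to its infimum there. -/
theorem exists_setLIntegral_sqrt_maxOp_le (n : ℕ) : ∃ K : ℝ≥0∞, K < ⊤ ∧
    ∀ (f : Rn n → ℝ) (c : Rn n) (R : ℝ), 0 < R → infMaxOp f c R ≠ 0 → infMaxOp f c R ≠ ⊤ →
      ∫⁻ x in cube c R,
        ENNReal.ofReal (((maxOp f x).toReal / (infMaxOp f c R).toReal) ^ (1 / 2 : ℝ))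
          ≤ K * volume (cube c R) := by
  refine ⟨1 + 15 ^ n * ∫⁻ t in Ioi (1 : ℝ), ENNReal.ofReal (t ^ (-2 : ℝ)), ?_, ?_⟩
  · have h : IntegrableOn (fun t : ℝ => t ^ (-2 : ℝ)) (Ioi 1) :=
      integrableOn_Ioi_rpow_of_lt (by norm_num) one_pos
    exact ENNReal.add_lt_top.2 ⟨ENNReal.one_lt_top,
      ENNReal.mul_lt_top (by finiteness) h.lintegral_lt_top⟩
  intro f c R hR hm0 hmt
  set m := infMaxOp f c R
  have hmpos : 0 < m.toReal := ENNReal.toReal_pos hm0 hmt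
  have hmeas : Measurable fun x => ((maxOp f x).toReal / m.toReal) ^ (1 / 2 : ℝ) :=
    ((measurable_maxOp f).ennreal_toReal.div_const _).pow_const _
  rw [lintegral_eq_lintegral_meas_lt _ (ae_of_all _ fun x => by positivity) hmeas.aemeasurable,
    ← Ioc_union_Ioi_eq_Ioi zero_le_one,
    lintegral_union measurableSet_Ioi (Set.disjoint_left.2 fun x hx hx' => not_lt.2 hx.2 hx'),
    add_mul]
  gcongr
  · calc _ ≤ ∫⁻ t in Ioc (0 : ℝ) 1, volume (cube c R) := by
          refine lintegral_mono fun t => ?_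
          rw [Measure.restrict_apply' (measurableSet_cube c hR.le)]
          exact measure_mono inter_subset_right
      _ = _ := by simp
  · calc _ ≤ ∫⁻ t in Ioi (1 : ℝ), 15 ^ n * volume (cube c R) * ENNReal.ofReal (t ^ (-2 : ℝ)) := by
          refine setLIntegral_mono' measurableSet_Ioi fun t ht => ?_
          have ht1 : 1 < t := ht
          have ht0 : 0 < t := one_pos.trans ht1
          rw [Measure.restrict_apply' (measurableSet_cube c hR.le)]
          have hsub : {x | t < ((maxOp f x).toReal / m.toReal) ^ (1 / 2 : ℝ)} ∩ cube c R ⊆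
              {x ∈ cube c R | ENNReal.ofReal (t ^ 2) * m < maxOp f x} := by
            rintro x ⟨hx, hxQ⟩
            refine ⟨hxQ, ?_⟩
            rw [mem_ofPred_eq, ← Real.sqrt_eq_rpow, Real.lt_sqrt ht0.le, lt_div_iff₀ hmpos] at hx
            rw [← ENNReal.ofReal_toReal hmt, ← ENNReal.ofReal_mul (by positivity)]
            exact ((ENNReal.ofReal_lt_ofReal_iff_of_nonneg (by positivity)).2 hx).trans_le
              ENNReal.ofReal_toReal_le
          have hw := volume_maxOp_gt_mul_le f c hR hm0 hmt (ENNReal.ofReal (t ^ 2))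
          rw [show t ^ (-2 : ℝ) = (t ^ 2)⁻¹ by rw [Real.rpow_neg ht0.le]; norm_cast,
            ENNReal.ofReal_inv_of_pos (by positivity), ← div_eq_mul_inv]
          refine (measure_mono hsub).trans ((ENNReal.le_div_iff_mul_le (Or.inl ?_)
            (Or.inl ENNReal.ofReal_ne_top)).2 hw)
          exact (ENNReal.ofReal_pos.2 (by positivity)).ne'
      _ = _ := by
          rw [lintegral_const_mul' _ _
            (ENNReal.mul_ne_top (by finiteness) (volume_cube_ne_top c hR.le))]
          ring

theorem ae_toReal_infMaxOp_le {n : ℕ} {f : Rn n → ℝ}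
    (hf : ∀ᵐ x : Rn n ∂volume, 0 < maxOp f x ∧ maxOp f x < ⊤) (c : Rn n) (r : ℝ) :
    ∀ᵐ x : Rn n ∂volume, x ∈ cube c r → (infMaxOp f c r).toReal ≤ (maxOp f x).toReal := by
  filter_upwards [hf] with x hx hxQ
  exact ENNReal.toReal_mono hx.2.ne (iInf₂_le x hxQ)

theorem ae_maxOp_rpow_mul_le {n : ℕ} {f g : Rn n → ℝ} {d e : ℝ} (hd : d ≤ 0) (he : e ≤ 0)
    (hf : ∀ᵐ x : Rn n ∂volume, 0 < maxOp f x ∧ maxOp f x < ⊤)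
    (hg : ∀ᵐ x : Rn n ∂volume, 0 < maxOp g x ∧ maxOp g x < ⊤) (c : Rn n) {r : ℝ} (hr : 0 < r) :
    ∀ᵐ x : Rn n ∂volume, x ∈ cube c r →
      (maxOp f x).toReal ^ d * (maxOp g x).toReal ^ e ≤
        (infMaxOp f c r).toReal ^ d * (infMaxOp g c r).toReal ^ e := by
  have hf0 := ENNReal.toReal_pos (infMaxOp_ne_zero (hf.mono fun _ h => h.1) c hr)
    (infMaxOp_ne_top (hf.mono fun _ h => h.2) c hr)
  have hg0 := ENNReal.toReal_pos (infMaxOp_ne_zero (hg.mono fun _ h => h.1) c hr)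
    (infMaxOp_ne_top (hg.mono fun _ h => h.2) c hr)
  filter_upwards [ae_toReal_infMaxOp_le hf c r, ae_toReal_infMaxOp_le hg c r] with x h1 h2 hx
  exact mul_le_mul (Real.rpow_le_rpow_of_nonpos hf0 (h1 hx) hd)
    (Real.rpow_le_rpow_of_nonpos hg0 (h2 hx) he) (by positivity) (by positivity)

theorem measurable_maxOp_rpow_mul {n : ℕ} (f g : Rn n → ℝ) (d e : ℝ) :
    Measurable fun x => (maxOp f x).toReal ^ d * (maxOp g x).toReal ^ e :=
  ((measurable_maxOp f).ennreal_toReal.pow_const _).mul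
    ((measurable_maxOp g).ennreal_toReal.pow_const _)

theorem isWeight_maxOp_rpow_mul {n : ℕ} {f g : Rn n → ℝ} {d e : ℝ} (hd : d ≤ 0) (he : e ≤ 0)
    (hf : ∀ᵐ x : Rn n ∂volume, 0 < maxOp f x ∧ maxOp f x < ⊤)
    (hg : ∀ᵐ x : Rn n ∂volume, 0 < maxOp g x ∧ maxOp g x < ⊤) :
    IsWeight fun x => (maxOp f x).toReal ^ d * (maxOp g x).toReal ^ e := by
  refine ⟨fun x => ⟨cube x 1, ?_, ?_⟩, ?_⟩
  · rw [cube_eq_closedBall x zero_le_one]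
    exact Metric.closedBall_mem_nhds x one_pos
  · refine Measure.integrableOn_of_bounded
      (M := (infMaxOp f x 1).toReal ^ d * (infMaxOp g x 1).toReal ^ e)
      (volume_cube_ne_top x zero_le_one)
      (measurable_maxOp_rpow_mul f g d e).aestronglyMeasurable ?_
    rw [ae_restrict_iff' (measurableSet_cube x zero_le_one)]
    filter_upwards [ae_maxOp_rpow_mul_le hd he hf hg x one_pos] with y hy hyQ
    rw [Real.norm_of_nonneg (by positivity)]
    exact hy hyQ
  · filter_upwards [hf, hg] with x h1 h2
    have := ENNReal.toReal_pos h1.1.ne' h1.2.ne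
    have := ENNReal.toReal_pos h2.1.ne' h2.2.ne
    positivity

theorem wMeasure_cube {n : ℕ} (w : Rn n → ℝ) (c : Rn n) {r : ℝ} (hr : 0 ≤ r) :
    wMeasure w (cube c r) = ∫⁻ x in cube c r, ENNReal.ofReal (w x) :=
  withDensity_apply _ (measurableSet_cube c hr)

theorem four_mul_volume_maxOp_gt_le {n : ℕ} (f : Rn n → ℝ) (c : Rn n) {r : ℝ} (hr : 0 < r)
    (hm0 : infMaxOp f c r ≠ 0) (hmt : infMaxOp f c r ≠ ⊤) :
    4 * volume {x ∈ cube c r | 4 * 15 ^ n * infMaxOp f c r < maxOp f x} ≤ volume (cube c r) := by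
  have h := volume_maxOp_gt_mul_le f c hr hm0 hmt (4 * 15 ^ n)
  refine (ENNReal.mul_le_mul_iff_right (a := 15 ^ n) (by positivity) (by finiteness)).1 ?_
  convert h using 1
  ring

theorem RHinfConst_maxOp_rpow_mul_le {n : ℕ} {f g : Rn n → ℝ} {d e : ℝ} (hd : d ≤ 0) (he : e ≤ 0)
    (hf : ∀ᵐ x : Rn n ∂volume, 0 < maxOp f x ∧ maxOp f x < ⊤)
    (hg : ∀ᵐ x : Rn n ∂volume, 0 < maxOp g x ∧ maxOp g x < ⊤) :
    RHinfConst (fun x => (maxOp f x).toReal ^ d * (maxOp g x).toReal ^ e) ≤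
      2 * ENNReal.ofReal ((4 * 15 ^ n) ^ (-(d + e))) := by
  refine iSup₂_le fun c r => iSup_le fun hr => ENNReal.div_le_of_le_mul ?_
  have hf0 := infMaxOp_ne_zero (hf.mono fun _ h => h.1) c hr
  have hft := infMaxOp_ne_top (hf.mono fun _ h => h.2) c hr
  have hg0 := infMaxOp_ne_zero (hg.mono fun _ h => h.1) c hr
  have hgt := infMaxOp_ne_top (hg.mono fun _ h => h.2) c hr
  have hBf := four_mul_volume_maxOp_gt_le f c hr hf0 hft
  have hBg := four_mul_volume_maxOp_gt_le g c hr hg0 hgt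
  have hfpos := ENNReal.toReal_pos hf0 hft
  have hgpos := ENNReal.toReal_pos hg0 hgt
  set V : ℝ := (infMaxOp f c r).toReal ^ d * (infMaxOp g c r).toReal ^ e with hV
  have hVpos : 0 < V := by positivity
  set G : Set (Rn n) := {x ∈ cube c r | maxOp f x ≤ 4 * 15 ^ n * infMaxOp f c r ∧
    maxOp g x ≤ 4 * 15 ^ n * infMaxOp g c r}
  have hGm : MeasurableSet G := (measurableSet_cube c hr.le).inter
    ((measurableSet_le (measurable_maxOp f) measurable_const).inter
      (measurableSet_le (measurable_maxOp g) measurable_const))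
  have hG : volume (cube c r) ≤ 2 * volume G := by
    set Bf := {x ∈ cube c r | 4 * 15 ^ n * infMaxOp f c r < maxOp f x}
    set Bg := {x ∈ cube c r | 4 * 15 ^ n * infMaxOp g c r < maxOp g x}
    have hcov : cube c r ⊆ G ∪ (Bf ∪ Bg) := by
      intro x hx
      by_cases h1 : 4 * 15 ^ n * infMaxOp f c r < maxOp f x
      · exact Or.inr (Or.inl ⟨hx, h1⟩)
      by_cases h2 : 4 * 15 ^ n * infMaxOp g c r < maxOp g x
      · exact Or.inr (Or.inr ⟨hx, h2⟩)
      exact Or.inl ⟨hx, not_lt.1 h1, not_lt.1 h2⟩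
    have h1 : volume (cube c r) ≤ volume G + (volume Bf + volume Bg) :=
      (measure_mono hcov).trans ((measure_union_le _ _).trans (by gcongr; exact measure_union_le _ _))
    have h2 : 2 * volume (cube c r) + 2 * volume (cube c r) ≤
        2 * (2 * volume G) + 2 * volume (cube c r) := by
      calc _ = 4 * volume (cube c r) := by ring
        _ ≤ 4 * (volume G + (volume Bf + volume Bg)) := by gcongr
        _ = 4 * volume G + (4 * volume Bf + 4 * volume Bg) := by ring
        _ ≤ 4 * volume G + (volume (cube c r) + volume (cube c r)) := by gcongr
        _ = _ := by ring
    have h3 := ENNReal.le_of_add_le_add_right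
      (ENNReal.mul_ne_top (by finiteness) (volume_cube_ne_top c hr.le)) h2
    exact (ENNReal.mul_le_mul_iff_right (by norm_num) (by finiteness)).1 h3
  have hess : essSup (fun x => ENNReal.ofReal ((maxOp f x).toReal ^ d * (maxOp g x).toReal ^ e))
      (volume.restrict (cube c r)) ≤ ENNReal.ofReal V := by
    refine essSup_le_of_ae_le _ ?_
    rw [EventuallyLE, ae_restrict_iff' (measurableSet_cube c hr.le)]
    filter_upwards [ae_maxOp_rpow_mul_le hd he hf hg c hr] with x hx hxQ
    exact ENNReal.ofReal_le_ofReal (hx hxQ)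
  have hlow : ENNReal.ofReal ((4 * 15 ^ n) ^ (d + e) * V) * volume G ≤
      wMeasure (fun x => (maxOp f x).toReal ^ d * (maxOp g x).toReal ^ e) (cube c r) := by
    rw [wMeasure_cube _ _ hr.le, ← setLIntegral_const]
    refine le_trans (setLIntegral_mono_ae' hGm ?_)
      (lintegral_mono_set (show G ⊆ cube c r from fun x hx => hx.1))
    have key : ∀ {h : Rn n → ℝ} {x : Rn n} {b : ℝ}, b ≤ 0 → 0 < maxOp h x → maxOp h x < ⊤ →
        infMaxOp h c r ≠ ⊤ →
        maxOp h x ≤ 4 * 15 ^ n * infMaxOp h c r →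
        (4 * 15 ^ n : ℝ) ^ b * (infMaxOp h c r).toReal ^ b ≤ (maxOp h x).toReal ^ b := by
      intro h x b hb h0 ht hmt hle
      rw [← Real.mul_rpow (by positivity) (by positivity)]
      refine Real.rpow_le_rpow_of_nonpos (ENNReal.toReal_pos h0.ne' ht.ne) ?_ hb
      have := ENNReal.toReal_mono (ENNReal.mul_ne_top (by finiteness) hmt) hle
      simpa using this
    filter_upwards [hf, hg] with x h1 h2 hx
    refine ENNReal.ofReal_le_ofReal ?_
    rw [Real.rpow_add (by positivity), hV, mul_mul_mul_comm]
    exact mul_le_mul (key hd h1.1 h1.2 hft hx.2.1) (key he h2.1 h2.2 hgt hx.2.2)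
      (by positivity) (by positivity)
  calc _ ≤ ENNReal.ofReal V * (2 * volume G) := by gcongr
    _ = 2 * ENNReal.ofReal ((4 * 15 ^ n) ^ (-(d + e))) *
        (ENNReal.ofReal ((4 * 15 ^ n) ^ (d + e) * V) * volume G) := by
        have : V = (4 * 15 ^ n) ^ (-(d + e)) * ((4 * 15 ^ n) ^ (d + e) * V) := by
          rw [← mul_assoc, ← Real.rpow_add (by positivity)]
          simp
        conv_lhs => rw [this, ENNReal.ofReal_mul (by positivity)]
        ring
    _ ≤ _ := by gcongr

theorem rpow_mul_rpow_le_sqrt_add_sqrt {x y a b : ℝ} (hx : 1 ≤ x) (hy : 1 ≤ y) (ha : 0 ≤ a)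
    (hb : 0 ≤ b) (hab : a + b ≤ 1 / 2) :
    x ^ a * y ^ b ≤ x ^ (1 / 2 : ℝ) + y ^ (1 / 2 : ℝ) := by
  wlog hxy : x ≤ y generalizing x y a b
  · rw [mul_comm, add_comm]
    exact this hy hx hb ha (by linarith) (le_of_not_ge hxy)
  have hy0 : 0 < y := by linarith
  calc x ^ a * y ^ b ≤ y ^ a * y ^ b := by gcongr
    _ = y ^ (a + b) := (Real.rpow_add hy0 _ _).symm
    _ ≤ y ^ (1 / 2 : ℝ) := Real.rpow_le_rpow_of_exponent_le hy hab
    _ ≤ _ := le_add_of_nonneg_left (by positivity)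

theorem rpow_neg_mul_le {u U C M N m k d e θ : ℝ} (hU : 0 < U) (hC : 0 < C) (hUu : U ≤ C * u)
    (hm : 0 < m) (hk : 0 < k) (hM : m ≤ M) (hN : k ≤ N) (hd : d ≤ 0) (he : e ≤ 0) (hθ : 0 ≤ θ)
    (hde : θ * (-d - e) ≤ 1 / 2) :
    (u * (M ^ d * N ^ e)) ^ (-θ) ≤ (U / C * (m ^ d * k ^ e)) ^ (-θ) *
      ((M / m) ^ (1 / 2 : ℝ) + (N / k) ^ (1 / 2 : ℝ)) := by
  have hu : U / C ≤ u := by rwa [div_le_iff₀' hC]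
  have hu0 : 0 < u := (div_pos hU hC).trans_le hu
  have hM0 : 0 < M := hm.trans_le hM
  have hN0 : 0 < N := hk.trans_le hN
  have hsplit : ∀ {A a b : ℝ}, 0 < a → 0 < A →
      (A ^ b) ^ (-θ) = (a ^ b) ^ (-θ) * (A / a) ^ (-(b * θ)) := by
    intro A a b ha hA
    rw [← Real.rpow_mul hA.le, ← Real.rpow_mul ha.le, Real.div_rpow hA.le ha.le, mul_neg]
    field_simp
  calc (u * (M ^ d * N ^ e)) ^ (-θ)
      ≤ (U / C * (M ^ d * N ^ e)) ^ (-θ) :=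
        Real.rpow_le_rpow_of_nonpos (by positivity) (by gcongr) (by linarith)
    _ = (U / C * (m ^ d * k ^ e)) ^ (-θ) * ((M / m) ^ (-(d * θ)) * (N / k) ^ (-(e * θ))) := by
        rw [Real.mul_rpow (by positivity) (by positivity),
          Real.mul_rpow (by positivity) (by positivity),
          Real.mul_rpow (by positivity) (by positivity),
          Real.mul_rpow (by positivity) (by positivity), hsplit hm hM0, hsplit hk hN0]
        ring
    _ ≤ _ := by
        gcongr
        refine rpow_mul_rpow_le_sqrt_add_sqrt ((one_le_div hm).2 hM) ((one_le_div hk).2 hN) ?_ ?_ ?_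
        · nlinarith
        · nlinarith
        · linarith

/-- An `A₁` weight times nonpositive powers of two maximal functions is in `A∞`. -/
theorem memAinf_mul_maxOp_rpow_mul {n : ℕ} {u f g : Rn n → ℝ} {d e : ℝ} (hu : MemA1 u)
    (hd : d ≤ 0) (he : e ≤ 0)
    (hf : ∀ᵐ x : Rn n ∂volume, 0 < maxOp f x ∧ maxOp f x < ⊤)
    (hg : ∀ᵐ x : Rn n ∂volume, 0 < maxOp g x ∧ maxOp g x < ⊤) :
    MemAinf fun x => u x * ((maxOp f x).toReal ^ d * (maxOp g x).toReal ^ e) := by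
  obtain ⟨⟨hloc, hupos⟩, hA1⟩ := hu
  obtain ⟨C₀, hC₀, hC₀t⟩ := sInf_lt_iff.1 hA1
  obtain ⟨K, hK, hKf⟩ := exists_setLIntegral_sqrt_maxOp_le n
  set C : ℝ := C₀.toReal + 1
  have hCpos : 0 < C := by positivity
  set s : ℝ := 2 + 2 * (-d - e) with hs
  have hs1 : 0 < s - 1 := by rw [hs]; linarith
  set θ : ℝ := (s - 1)⁻¹
  have hθ : 0 < θ := inv_pos.2 hs1
  have hexp : 1 - s / (s - 1) = -θ := by
    simp only [θ]; field_simp; ring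
  refine ⟨s, by linarith, lt_of_le_of_lt (b := ENNReal.ofReal C * (2 * K) ^ (s - 1)) ?_
    (ENNReal.mul_lt_top ENNReal.ofReal_lt_top
      (ENNReal.rpow_lt_top_of_nonneg hs1.le (by finiteness)))⟩
  refine iSup₂_le fun c r => iSup_le fun hr => ?_
  rw [hexp, wMeasure_cube _ _ hr.le]
  have hQ0 := volume_cube_ne_zero c hr
  have hQt := volume_cube_ne_top c hr.le
  have hQm := measurableSet_cube c hr.le
  have hf0 := infMaxOp_ne_zero (hf.mono fun _ h => h.1) c hr
  have hft := infMaxOp_ne_top (hf.mono fun _ h => h.2) c hr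
  have hg0 := infMaxOp_ne_zero (hg.mono fun _ h => h.1) c hr
  have hgt := infMaxOp_ne_top (hg.mono fun _ h => h.2) c hr
  have hfpos := ENNReal.toReal_pos hf0 hft
  have hgpos := ENNReal.toReal_pos hg0 hgt
  have hKF := hKf f c r hr hf0 hft
  have hKG := hKf g c r hr hg0 hgt
  have haele := ae_maxOp_rpow_mul_le hd he hf hg c hr
  have hfle := ae_toReal_infMaxOp_le hf c r
  have hgle := ae_toReal_infMaxOp_le hg c r
  set m := (infMaxOp f c r).toReal
  set k := (infMaxOp g c r).toReal
  set I := ∫⁻ x in cube c r, ENNReal.ofReal (u x) with hI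
  have hIabs : ∫⁻ x in cube c r, ENNReal.ofReal |u x| = I := by
    refine lintegral_congr_ae (ae_restrict_of_ae ?_)
    filter_upwards [hupos] with x hx
    rw [abs_of_pos hx]
  have hint : IntegrableOn u (cube c r) := by
    refine hloc.integrableOn_isCompact ?_
    rw [cube_eq_closedBall c hr.le]
    exact isCompact_closedBall c r
  have hIt : I ≠ ⊤ := hint.lintegral_lt_top.ne
  have hI0 : I ≠ 0 := by
    intro h
    rw [hI, lintegral_eq_zero_iff' hint.aestronglyMeasurable.aemeasurable.ennreal_ofReal,
      EventuallyEq, ae_restrict_iff' hQm] at h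
    refine hQ0 (measure_mono_null (fun x hx => ?_) (h.and hupos))
    intro hcon
    have h1 := hcon.1 hx
    simp only [Pi.zero_apply, ENNReal.ofReal_eq_zero] at h1
    exact absurd hcon.2 (not_lt.2 h1)
  have hUt : I / volume (cube c r) ≠ ⊤ := ENNReal.div_ne_top hIt hQ0
  have hU0 : I / volume (cube c r) ≠ 0 := ENNReal.div_ne_zero.2 ⟨hI0, hQt⟩
  set U := (I / volume (cube c r)).toReal
  have hUpos : 0 < U := ENNReal.toReal_pos hU0 hUt
  have hUof : ENNReal.ofReal U = I / volume (cube c r) := ENNReal.ofReal_toReal hUt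
  set V := m ^ d * k ^ e with hV
  have hVpos : 0 < V := by positivity
  have hae : ∀ᵐ x : Rn n ∂volume, x ∈ cube c r → U ≤ C * u x := by
    filter_upwards [hC₀, hupos] with x hx hux hxQ
    have h1 := (setLIntegral_cube_div_le_maxOp u c x hr hxQ).trans hx
    rw [hIabs, ← hUof, ← ENNReal.ofReal_toReal hC₀t.ne, ← ENNReal.ofReal_mul (by positivity),
      ENNReal.ofReal_le_ofReal_iff (by positivity)] at h1
    refine h1.trans ?_
    gcongr
    exact le_add_of_nonneg_right zero_le_one
  have hfirst : (∫⁻ x in cube c r, ENNReal.ofReal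
      (u x * ((maxOp f x).toReal ^ d * (maxOp g x).toReal ^ e))) / volume (cube c r) ≤
      ENNReal.ofReal (U * V) := by
    rw [ENNReal.ofReal_mul hUpos.le, hUof, ENNReal.mul_comm_div, mul_div_assoc', div_eq_mul_inv,
      div_eq_mul_inv]
    gcongr
    rw [hI, ← lintegral_mul_const' _ _ ENNReal.ofReal_ne_top]
    refine setLIntegral_mono_ae' hQm ?_
    filter_upwards [haele, hupos] with x hx hux hxQ
    rw [ENNReal.ofReal_mul hux.le]
    gcongr
    exact hx hxQ
  have hsecond : (∫⁻ x in cube c r, ENNReal.ofReal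
      ((u x * ((maxOp f x).toReal ^ d * (maxOp g x).toReal ^ e)) ^ (-θ))) / volume (cube c r) ≤
      ENNReal.ofReal ((U / C * V) ^ (-θ)) * (2 * K) := by
    rw [ENNReal.div_le_iff hQ0 hQt]
    calc _ ≤ ∫⁻ x in cube c r, ENNReal.ofReal ((U / C * V) ^ (-θ)) *
          (ENNReal.ofReal (((maxOp f x).toReal / m) ^ (1 / 2 : ℝ)) +
            ENNReal.ofReal (((maxOp g x).toReal / k) ^ (1 / 2 : ℝ))) := by
          refine setLIntegral_mono_ae' hQm ?_
          filter_upwards [hae, hfle, hgle] with x h1 h2 h3 hxQ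
          rw [← ENNReal.ofReal_add (by positivity) (by positivity),
            ← ENNReal.ofReal_mul (by positivity)]
          refine ENNReal.ofReal_le_ofReal (rpow_neg_mul_le hUpos hCpos (h1 hxQ) hfpos hgpos
            (h2 hxQ) (h3 hxQ) hd he hθ.le ?_)
          rw [inv_mul_le_iff₀ hs1, hs]
          linarith
      _ = ENNReal.ofReal ((U / C * V) ^ (-θ)) *
          ((∫⁻ x in cube c r, ENNReal.ofReal (((maxOp f x).toReal / m) ^ (1 / 2 : ℝ))) +
            ∫⁻ x in cube c r, ENNReal.ofReal (((maxOp g x).toReal / k) ^ (1 / 2 : ℝ))) := by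
          rw [lintegral_const_mul' _ _ ENNReal.ofReal_ne_top, lintegral_add_left]
          exact (((measurable_maxOp f).ennreal_toReal.div_const _).pow_const _).ennreal_ofReal
      _ ≤ ENNReal.ofReal ((U / C * V) ^ (-θ)) *
          (K * volume (cube c r) + K * volume (cube c r)) := by gcongr
      _ = _ := by ring
  calc _ ≤ ENNReal.ofReal (U * V) *
        (ENNReal.ofReal ((U / C * V) ^ (-θ)) * (2 * K)) ^ (s - 1) := by gcongr
    _ = ENNReal.ofReal C * (2 * K) ^ (s - 1) := by
        rw [ENNReal.mul_rpow_of_nonneg _ _ hs1.le,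
          ENNReal.ofReal_rpow_of_nonneg (by positivity) hs1.le,
          ← Real.rpow_mul (by positivity), show -θ * (s - 1) = -1 by simp only [θ]; field_simp,
          ← mul_assoc, ← ENNReal.ofReal_mul (by positivity), Real.rpow_neg_one]
        congr 2
        field_simp

theorem RH1Const_mul_le {n : ℕ} {u v : Rn n → ℝ} (hu : MemA1 u) (hv : IsWeight v)
    (hRH : RHinfConst v < ⊤) : RH1Const (fun x => u x * v x) ≤ A1Const u * RHinfConst v := by
  refine sInf_le ?_
  exact ⟨u, v, fun _ => rfl, hu, hv, hRH, rfl⟩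

/-- If `w = u (Mh₁)^{α(1-q)} (Mh₂)^{(1-α)(1-q)} ∈ Â_{q,2}`, then `w ∈ A∞` with
`[w]_{RH∞¹} ≲ [u]_{A₁}`; in particular the factor `v` is in `RH∞` with constant
depending only on `α`, `q` (and the dimension). -/
theorem stmt5 (n : ℕ) (q a : ℝ) (hq : 1 ≤ q) (ha0 : 0 ≤ a) (ha1 : a ≤ 1) :
    ∃ C Cv : ℝ≥0∞, C < ⊤ ∧ Cv < ⊤ ∧
      ∀ u h1 h2 : Rn n → ℝ, MemA1 u →
        LocallyIntegrable h1 volume → LocallyIntegrable h2 volume →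
        (∀ᵐ x : Rn n ∂volume, 0 < maxOp h1 x ∧ maxOp h1 x < ⊤) →
        (∀ᵐ x : Rn n ∂volume, 0 < maxOp h2 x ∧ maxOp h2 x < ⊤) →
        MemAinf (fun x => u x * ((maxOp h1 x).toReal ^ (a * (1 - q)) *
            (maxOp h2 x).toReal ^ ((1 - a) * (1 - q)))) ∧
        RHinfConst (fun x => (maxOp h1 x).toReal ^ (a * (1 - q)) *
            (maxOp h2 x).toReal ^ ((1 - a) * (1 - q))) ≤ Cv ∧
        RH1Const (fun x => u x * ((maxOp h1 x).toReal ^ (a * (1 - q)) *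
            (maxOp h2 x).toReal ^ ((1 - a) * (1 - q)))) ≤ C * A1Const u := by
  have hd : a * (1 - q) ≤ 0 := mul_nonpos_of_nonneg_of_nonpos ha0 (by linarith)
  have he : (1 - a) * (1 - q) ≤ 0 := mul_nonpos_of_nonneg_of_nonpos (by linarith) (by linarith)
  refine ⟨2 * ENNReal.ofReal ((4 * 15 ^ n) ^ (-(a * (1 - q) + (1 - a) * (1 - q)))),
    2 * ENNReal.ofReal ((4 * 15 ^ n) ^ (-(a * (1 - q) + (1 - a) * (1 - q)))),
    by finiteness, by finiteness, fun u h1 h2 hu _ _ hM1 hM2 => ?_⟩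
  have hRH := RHinfConst_maxOp_rpow_mul_le hd he hM1 hM2
  refine ⟨memAinf_mul_maxOp_rpow_mul hu hd he hM1 hM2, hRH, ?_⟩
  calc _ ≤ A1Const u * RHinfConst _ := RH1Const_mul_le hu (isWeight_maxOp_rpow_mul hd he hM1 hM2)
        (hRH.trans_lt (by finiteness))
    _ ≤ A1Const u * _ := by gcongr
    _ = _ := mul_comm _ _
end
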